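/- Let R be a commutative ring, x, y, t ∈ R, and n a positive integer. For every nonnegative integer k, the n×n determinant det_{0≤i,j≤n−1}(P_{j+1}(i,k) − t·(xy)^{i+1}·P_{j+1}(−i−2,k)) equals (−1)^{n₁·C(k+1,2)}·t^{k⌊n₁/2⌋}·(xy)^{(k+1)²·C(n₁,2)}·Σ_{s=0}^{n₁} t^{min(s,n₁−s)} x^{s(k+1)} y^{(n₁−s)(k+1)} if n = n₁(k+1) for a positive integer n₁; it equals (−1)^{n₁·C(k+1,2)+C(k,2)}·t^{k⌈n₁/2⌉}·(xy)^{(k+1)²·C(n₁,2)+n₁k(k+1)}·Σ_{s=0}^{n₁} t^{min(s,n₁−s)} x^{s(k+1)} y^{(n₁−s)(k+1)} if n = n₁(k+1)+k for a nonnegative integer n₁; and it equals 0 if n is congruent to neither 0 nor k modulo k+1. Moreover, for k = −1, det_{0≤i,j≤n−1}(P_{j+1}(i,−1) − t·(xy)^{i+1}·P_{j+1}(−i−2,−1)) = (1−t)^n·(xy)^{C(n+1,2)}. -/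

import Mathlib

/-- `pgf x y n k` is the generating function `P_n(0,k)` of lattice paths from `(0,0)` to
`(n,k)` with steps `(1,1)`, `(1,0)`, `(1,-1)`, weighted `1`, `x+y`, `xy` respectively:
`P_n(0,k) = Σ_ℓ C(n,ℓ)·C(n,n−k−ℓ)·x^ℓ·y^{n−k−ℓ}`, the sum over integers `ℓ ≥ 0` with
`n−k−ℓ ≥ 0` (terms with `ℓ > n` vanish since then `C(n,ℓ) = 0`).
`P_n(l,k)` is then `pgf x y n (k - l)`. -/
def pgf {R : Type*} [CommRing R] (x y : R) (n : ℕ) (k : ℤ) : R :=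
  ∑ ℓ ∈ Finset.range (n + 1),
    if (ℓ : ℤ) ≤ (n : ℤ) - k then
      (n.choose ℓ : R) * (n.choose ((n : ℤ) - k - ℓ).toNat : R) *
        x ^ ℓ * y ^ ((n : ℤ) - k - ℓ).toNat
    else 0

/-- The matrix of Theorem 9, with `(i,j)`-entry
`P_{j+1}(i,k) − t·(xy)^{i+1}·P_{j+1}(−i−2,k)
  = pgf x y (j+1) (k−i) − t·(xy)^{i+1}·pgf x y (j+1) (k+i+2)`. -/
def thm9Matrix {R : Type*} [CommRing R] (x y t : R) (n : ℕ) (k : ℤ) :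
    Matrix (Fin n) (Fin n) R :=
  Matrix.of fun i j =>
    pgf x y (j.1 + 1) (k - i.1) - t * (x * y) ^ (i.1 + 1) * pgf x y (j.1 + 1) (k + i.1 + 2)

open Polynomial in
theorem pgf_eq_coeff {R : Type*} [CommRing R] (x y : R) (n : ℕ) (k : ℤ) :
    pgf x y n k = if k ≤ n then
      ((1 + C x * X) ^ n * (1 + C y * X) ^ n : R[X]).coeff ((n : ℤ) - k).toNat else 0 := by
  have hc : ∀ (z : R) (l : ℕ), ((1 + C z * X) ^ n : R[X]).coeff l = n.choose l * z ^ l := by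
    intro z l
    have : ((1 + C z * X) ^ n : R[X]) = ((1 + X) ^ n : R[X]).comp (C z * X) := by simp
    rw [this, comp_C_mul_X_coeff, coeff_one_add_X_pow]
  unfold pgf
  split_ifs with hk
  · obtain ⟨m, hm⟩ : ∃ m : ℕ, (n : ℤ) - k = m := ⟨_, (Int.toNat_of_nonneg (by omega)).symm⟩
    rw [coeff_mul, Finset.Nat.sum_antidiagonal_eq_sum_range_succ_mk]
    simp only [hc, hm, Int.toNat_natCast, Nat.cast_le]
    have hsub : ∀ ℓ : ℕ, ((m : ℤ) - ℓ).toNat = m - ℓ := fun ℓ => by omega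
    simp only [hsub]
    rw [← Finset.sum_filter]
    have h2 : ∑ ℓ ∈ Finset.range (m + 1),
        (n.choose ℓ : R) * x ^ ℓ * ((n.choose (m - ℓ) : R) * y ^ (m - ℓ)) =
        ∑ ℓ ∈ Finset.range (m + 1) with ℓ ≤ n,
          (n.choose ℓ : R) * x ^ ℓ * ((n.choose (m - ℓ) : R) * y ^ (m - ℓ)) := by
      rw [Finset.sum_filter_of_ne]
      intro ℓ _ h
      by_contra hlt
      exact h (by simp [Nat.choose_eq_zero_of_lt (not_le.mp hlt)])
    rw [h2]
    refine Finset.sum_congr ?_ fun ℓ _ => by ring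
    ext ℓ
    simp only [Finset.mem_filter, Finset.mem_range]
    omega
  · refine Finset.sum_eq_zero fun ℓ _ => if_neg (by omega)

theorem pgf_zero {R : Type*} [CommRing R] (x y : R) (k : ℤ) :
    pgf x y 0 k = if k = 0 then 1 else 0 := by
  simp only [pgf_eq_coeff, pow_zero, mul_one, Polynomial.coeff_one]
  split_ifs <;> first | rfl | omega

open Polynomial in
theorem pgf_succ {R : Type*} [CommRing R] (x y : R) (n : ℕ) (k : ℤ) :
    pgf x y (n + 1) k =
      pgf x y n (k - 1) + (x + y) * pgf x y n k + x * y * pgf x y n (k + 1) := by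
  simp only [pgf_eq_coeff]
  set Q : R[X] := (1 + C x * X) ^ n * (1 + C y * X) ^ n with hQ
  have hs : ((1 + C x * X) ^ (n + 1) * (1 + C y * X) ^ (n + 1) : R[X]) =
      Q + C (x + y) * (Q * X) + C (x * y) * (Q * X * X) := by
    rw [hQ, C_add, C_mul]; ring
  rw [hs]
  by_cases h0 : (n : ℤ) + 1 < k
  · rw [if_neg, if_neg, if_neg, if_neg] <;> first | (simp; done) | (push_cast; omega)
  obtain ⟨m, hm⟩ : ∃ m : ℕ, k = n + 1 - m := ⟨((n : ℤ) + 1 - k).toNat, by omega⟩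
  subst hm
  have e1 : (((n + 1 : ℕ) : ℤ) - (n + 1 - m)).toNat = m := by push_cast; omega
  have e2 : ((n : ℤ) - (n + 1 - m - 1)).toNat = m := by omega
  have e3 : ((n : ℤ) - (n + 1 - m)).toNat = m - 1 := by omega
  have e4 : ((n : ℤ) - (n + 1 - m + 1)).toNat = m - 2 := by omega
  rw [e1, e2, e3, e4, if_pos (by push_cast; omega), if_pos (by omega)]
  rcases m with _ | _ | m
  · rw [if_neg (by simp), if_neg (by simp)]; simp
  · rw [if_pos (by simp), if_neg (by simp)]
    simp only [coeff_add, coeff_C_mul, coeff_mul_X]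
    simp
  · rw [if_pos (by push_cast; omega), if_pos (by push_cast; omega)]
    simp only [coeff_add, coeff_C_mul, coeff_mul_X]
    simp

/-- The sequence of coefficients of the Laurent polynomial
`u ^ (j + 1) + (x * y / u) ^ (j + 1) - (-x) ^ (j + 1) - (-y) ^ (j + 1)` in `u`. -/
def symBasis {R : Type*} [CommRing R] (x y : R) (j : ℕ) : ℤ → R := fun m =>
  (if m = j + 1 then 1 else 0) + (if m = -(j + 1) then (x * y) ^ (j + 1) else 0) -
    (if m = 0 then (-x) ^ (j + 1) + (-y) ^ (j + 1) else 0)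

/-- Multiplication by `u + (x + y) + x * y / u` on coefficient sequences. -/
def pathStep {R : Type*} [CommRing R] (x y : R) : (ℤ → R) →ₗ[R] (ℤ → R) where
  toFun g := fun k => g (k - 1) + (x + y) * g k + x * y * g (k + 1)
  map_add' g h := by ext k; simp only [Pi.add_apply]; ring
  map_smul' c g := by ext k; simp only [Pi.smul_apply, smul_eq_mul, RingHom.id_apply]; ring

theorem pathStep_symBasis {R : Type*} [CommRing R] (x y : R) (j : ℕ) :
    pathStep x y (symBasis x y j) = symBasis x y (j + 1) + (x + y) • symBasis x y j +
      (if j = 0 then 0 else (x * y) • symBasis x y (j - 1)) -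
      ((-x) ^ (j + 1) + (-y) ^ (j + 1)) • symBasis x y 0 := by
  ext k
  rcases j with _ | j
  · simp only [pathStep, symBasis, LinearMap.coe_mk, AddHom.coe_mk, Pi.add_apply, Pi.sub_apply,
      Pi.smul_apply, smul_eq_mul]
    push_cast
    by_cases h0 : k = 0
    · subst h0; norm_num; ring
    by_cases h1 : k = 1
    · subst h1; norm_num; ring
    by_cases h2 : k = -1
    · subst h2; norm_num; ring
    by_cases h3 : k = 2
    · subst h3; norm_num
    by_cases h4 : k = -2
    · subst h4; norm_num; ring
    simp (discharger := omega) only [if_neg]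
    simp
  · simp only [pathStep, symBasis, LinearMap.coe_mk, AddHom.coe_mk, Pi.add_apply, Pi.sub_apply,
      Pi.smul_apply, smul_eq_mul, Nat.add_one_sub_one, if_neg (Nat.succ_ne_zero j)]
    push_cast
    have c1 : k - 1 = j + 1 + 1 ↔ k = j + 1 + 1 + 1 := by omega
    have c2 : k - 1 = -(j + 1 + 1) ↔ k = -(j + 1) := by omega
    have c3 : k - 1 = 0 ↔ k = 1 := by omega
    have c4 : k + 1 = j + 1 + 1 ↔ k = j + 1 := by omega
    have c5 : k + 1 = -(j + 1 + 1) ↔ k = -(j + 1 + 1 + 1) := by omega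
    have c6 : k + 1 = 0 ↔ k = -1 := by omega
    simp only [c1, c2, c3, c4, c5, c6]
    have : ∀ (p : Prop) [Decidable p] (a : R), (if p then a else 0) = a * (if p then 1 else 0) := by
      intro p _ a; split_ifs <;> simp
    simp only [this _ ((x * y) ^ _), this _ (_ + _)]
    ring

theorem pgf_one {R : Type*} [CommRing R] (x y : R) : pgf x y 1 = symBasis x y 0 := by
  ext k
  rw [pgf_succ]
  simp only [pgf_zero, symBasis]
  by_cases h0 : k = 0
  · subst h0; norm_num; ring
  by_cases h1 : k = 1
  · subst h1; norm_num
  by_cases h2 : k = -1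
  · subst h2; norm_num
  push_cast
  simp (discharger := omega) only [if_neg]
  simp

theorem pgf_sub_symBasis_mem {R : Type*} [CommRing R] (x y : R) (j : ℕ) :
    pgf x y (j + 1) - symBasis x y j ∈
      Submodule.span R (symBasis x y '' (Finset.range j : Set ℕ)) := by
  induction j with
  | zero => simp [pgf_one]
  | succ j ih =>
    have hstep : pgf x y (j + 1 + 1) = pathStep x y (pgf x y (j + 1)) := by
      ext k; rw [pgf_succ]; rfl
    set W := Submodule.span R (symBasis x y '' (Finset.range (j + 1) : Set ℕ)) with hW
    have hb : ∀ i, i < j + 1 → symBasis x y i ∈ W := fun i hi =>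
      Submodule.subset_span ⟨i, by simpa using hi, rfl⟩
    have hpart : ∀ i, i < j + 1 → pathStep x y (symBasis x y i) - symBasis x y (i + 1) ∈ W := by
      intro i hi
      rw [pathStep_symBasis]
      have : ∀ a b c d : ℤ → R, a + b + c - d - a = b + c - d := fun a b c d => by abel
      rw [this]
      refine W.sub_mem (W.add_mem (W.smul_mem _ (hb i hi)) ?_) (W.smul_mem _ (hb 0 (by omega)))
      split_ifs
      · exact W.zero_mem
      · exact W.smul_mem _ (hb _ (by omega))
    have hlow : pathStep x y (pgf x y (j + 1) - symBasis x y j) ∈ W := by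
      refine (Submodule.map_le_iff_le_comap.mp ?_ : _ ≤ W.comap (pathStep x y)) ih
      rw [Submodule.map_span, Submodule.span_le]
      rintro _ ⟨_, ⟨i, hi, rfl⟩, rfl⟩
      have hi' : i < j := by simpa using hi
      have := W.add_mem (hpart i (by omega)) (hb (i + 1) (by omega))
      simpa using this
    have := W.add_mem hlow (hpart j (by omega))
    rw [map_sub] at this
    rw [hstep]
    convert this using 1
    abel

/-- The functional giving row `i` of the matrix `thm9Matrix`. -/
def rowFunctional {R : Type*} [CommRing R] (q t : R) (k : ℤ) (i : ℕ) : (ℤ → R) →ₗ[R] R where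
  toFun g := g (k - i) - t * q ^ (i + 1) * g (k + i + 2)
  map_add' g h := by simp only [Pi.add_apply]; ring
  map_smul' c g := by simp only [Pi.smul_apply, smul_eq_mul, RingHom.id_apply]; ring

theorem det_thm9Matrix_eq {R : Type*} [CommRing R] (x y t : R) (n : ℕ) (k : ℤ) :
    (thm9Matrix x y t n k).det =
      (Matrix.of fun i j : Fin n => rowFunctional (x * y) t k i (symBasis x y j)).det := by
  have h : ∀ j : ℕ, ∃ c : ℕ → R,
      pgf x y (j + 1) = symBasis x y j + ∑ l ∈ Finset.range j, c l • symBasis x y l := by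
    intro j
    obtain ⟨c, hc⟩ := (Submodule.mem_span_image_finset_iff_exists_fun' R).mp
      (pgf_sub_symBasis_mem x y j)
    exact ⟨c, by rw [hc]; abel⟩
  choose c hc using h
  let U : Matrix (Fin n) (Fin n) R := Matrix.of fun l j =>
    if l = j then 1 else if l < j then c j l else 0
  have hU : U.det = 1 := by
    rw [Matrix.det_of_isUpperTriangular]
    · simp [U]
    · intro i j hij
      simp only [id] at hij
      simp [U, hij.ne', hij.not_gt]
  have hM : thm9Matrix x y t n k =
      (Matrix.of fun i j : Fin n => rowFunctional (x * y) t k i (symBasis x y j)) * U := by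
    ext i j
    have h1 : thm9Matrix x y t n k i j = rowFunctional (x * y) t k i (pgf x y (j + 1)) := rfl
    rw [h1, hc, map_add, map_sum, Matrix.mul_apply]
    simp only [map_smul, smul_eq_mul, Matrix.of_apply, U]
    rw [← Finset.add_sum_erase _ _ (Finset.mem_univ j)]
    simp only [if_true, mul_one]
    congr 1
    have h3 : ∑ l ∈ Finset.range j, c j l * rowFunctional (x * y) t k i (symBasis x y l) =
        ∑ l ∈ Finset.range n, if l < (j : ℕ) then
          c j l * rowFunctional (x * y) t k i (symBasis x y l) else 0 := by
      rw [← Finset.sum_filter]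
      refine Finset.sum_congr ?_ fun _ _ => rfl
      ext l
      simp only [Finset.mem_filter, Finset.mem_range]
      omega
    rw [h3, ← Fin.sum_univ_eq_sum_range
      (fun l => if l < (j : ℕ) then
          c j l * rowFunctional (x * y) t k i (symBasis x y l) else 0)]
    rw [← Finset.sum_subset (Finset.subset_univ (Finset.univ.erase j))]
    · refine Finset.sum_congr rfl fun l hl => ?_
      have : l ≠ j := by simpa using hl
      simp only [this, if_false, Fin.lt_def]
      split_ifs <;> ring
    · intro l _ hl
      have : l = j := by simpa using hl
      simp [this]
  rw [hM, Matrix.det_mul, hU, mul_one]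

theorem sum_range_add_one (n : ℕ) : ∑ i ∈ Finset.range n, (i + 1) = (n + 1).choose 2 := by
  induction n with
  | zero => rfl
  | succ n ih => rw [Finset.sum_range_succ, ih, Nat.choose_succ_succ' (n + 1) 1,
      Nat.choose_one_right, add_comm]

theorem det_thm9Matrix_neg_one {R : Type*} [CommRing R] (x y t : R) (n : ℕ) :
    (thm9Matrix x y t n (-1 : ℤ)).det = (1 - t) ^ n * (x * y) ^ Nat.choose (n + 1) 2 := by
  have h : (Matrix.of fun i j : Fin n =>
      rowFunctional (x * y) t (-1) i (symBasis x y j)) =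
      Matrix.diagonal fun i : Fin n => (1 - t) * (x * y) ^ (i.1 + 1) := by
    ext i j
    simp only [rowFunctional, symBasis, LinearMap.coe_mk, AddHom.coe_mk, Matrix.of_apply,
      Matrix.diagonal_apply, Fin.ext_iff]
    by_cases hij : (i : ℕ) = j
    · rw [if_pos hij, hij, if_neg (by omega), if_pos (by omega), if_neg (by omega),
        if_pos (by omega), if_neg (by omega), if_neg (by omega)]
      ring
    · simp (discharger := omega) only [if_neg]
      simp
  rw [det_thm9Matrix_eq, h, Matrix.det_diagonal, Finset.prod_mul_distrib, Finset.prod_const,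
    Finset.card_univ, Fintype.card_fin, Finset.prod_pow_eq_pow_sum,
    Fin.sum_univ_eq_sum_range (fun i => i + 1)]
  rw [sum_range_add_one]

/-- The sparse coefficients left after reducing the columns of `thm9Matrix`, rows and columns
being numbered from `1`, with one further column numbered `0`. -/
def sparseCoeff {R : Type*} [CommRing R] (q t : R) (N a c : ℕ) : R :=
  (if a + c = N then 1 else 0) + (if a = N + c ∧ 1 ≤ c then q ^ c else 0) -
    (if c = a + N then t * q ^ a else 0)

/-- The matrix of the coefficients `sparseCoeff q t N`, bordered by the row `e`. -/
def borderedMatrix {R : Type*} [CommRing R] (q t : R) (N M : ℕ) (e : ℕ → R) :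
    Matrix (Fin M) (Fin M) R :=
  Matrix.of fun a c => if a.1 = 0 then e c else sparseCoeff q t N a c

theorem det_thm9Matrix_eq_det_borderedMatrix {R : Type*} [CommRing R] (x y t : R) (n k : ℕ) :
    (thm9Matrix x y t n (k : ℤ)).det = (borderedMatrix (x * y) t (k + 1) (1 + n)
      fun c => if c = 0 then 1 else (-x) ^ c + (-y) ^ c).det := by
  rw [det_thm9Matrix_eq, ← Matrix.det_submatrix_equiv_self finSumFinEquiv (borderedMatrix _ _ _ _ _),
    ← Matrix.fromBlocks_toBlocks ((borderedMatrix _ _ _ _ _).submatrix _ _)]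
  rw [show ((borderedMatrix (x * y) t (k + 1) (1 + n)
      fun c => if c = 0 then 1 else (-x) ^ c + (-y) ^ c).submatrix
      finSumFinEquiv finSumFinEquiv).toBlocks₁₁ = 1 by
    ext i j
    have hi : (finSumFinEquiv (Sum.inl j : Fin 1 ⊕ Fin n)).val = 0 := by simp
    rw [Subsingleton.elim i j, Matrix.one_apply_eq]
    simp only [Matrix.toBlocks₁₁, borderedMatrix, Matrix.of_apply, Matrix.submatrix_apply, hi,
      if_true]]
  rw [Matrix.det_fromBlocks_one₁₁]
  congr 1
  ext i j
  simp only [rowFunctional, symBasis, LinearMap.coe_mk, AddHom.coe_mk, Matrix.of_apply,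
    Matrix.toBlocks₂₂, Matrix.toBlocks₂₁, Matrix.toBlocks₁₂, Matrix.sub_apply, Matrix.mul_apply,
    borderedMatrix, Matrix.submatrix_apply, finSumFinEquiv_apply_left, finSumFinEquiv_apply_right,
    Fin.val_natAdd, Fin.val_castAdd, sparseCoeff, Finset.univ_unique, Finset.sum_singleton,
    Fin.default_eq_zero, Fin.val_zero]
  have c1 : (k : ℤ) - i = j + 1 ↔ 1 + (i : ℕ) + (1 + j) = k + 1 := by omega
  have c2 : (k : ℤ) - i = -(j + 1) ↔ 1 + (i : ℕ) = k + 1 + (1 + j) := by omega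
  have c3 : (k : ℤ) + i + 2 = j + 1 ↔ 1 + (j : ℕ) = 1 + i + (k + 1) := by omega
  have c4 : (k : ℤ) - i = 0 ↔ 1 + (i : ℕ) + 0 = k + 1 := by omega
  have c5 : ¬ (k : ℤ) + i + 2 = -(j + 1) := by omega
  have c6 : ¬ (k : ℤ) + i + 2 = 0 := by omega
  have c7 : ¬ 1 + (i : ℕ) = 0 := by omega
  have c8 : ¬ 1 + (j : ℕ) = 0 := by omega
  have c9 : ¬ 0 = 1 + (i : ℕ) + (k + 1) := by omega
  have c10 : 1 ≤ 1 + (j : ℕ) := by omega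
  have c11 : ¬ 1 ≤ 0 := by omega
  simp only [c1, c2, c3, c4, c5, c6, c7, c8, c9, c10, c11, and_true, and_false, if_false, if_true,
    add_comm (i : ℕ) 1, add_comm (j : ℕ) 1]
  split_ifs <;> ring

theorem det_fromBlocks_zero_corner {R m : Type*} [CommRing R] [Fintype m] [DecidableEq m]
    (Z B C : Matrix m m R) :
    (Matrix.fromBlocks Z B C 0).det = (-1) ^ Fintype.card m * B.det * C.det := by
  have hswap : (Matrix.fromBlocks 0 1 1 0 : Matrix (m ⊕ m) (m ⊕ m) R).det =
      (-1) ^ Fintype.card m := by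
    have h1 : (Matrix.fromBlocks 1 1 0 1 : Matrix (m ⊕ m) (m ⊕ m) R) *
        Matrix.fromBlocks 0 1 1 0 = Matrix.fromBlocks 1 1 1 0 := by
      simp [Matrix.fromBlocks_multiply]
    have h2 := congrArg Matrix.det h1
    rw [Matrix.det_mul, Matrix.det_fromBlocks_zero₂₁, Matrix.det_fromBlocks_one₁₁] at h2
    simpa [Matrix.det_neg] using h2
  have h : Matrix.fromBlocks Z B C 0 =
      Matrix.fromBlocks B Z 0 C * (Matrix.fromBlocks 0 1 1 0 : Matrix (m ⊕ m) (m ⊕ m) R) := by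
    simp [Matrix.fromBlocks_multiply]
  rw [h, Matrix.det_mul, hswap, Matrix.det_fromBlocks_zero₂₁]
  ring

theorem det_fromBlocks_mul_right_block {R m n : Type*} [CommRing R] [Fintype m] [DecidableEq m]
    [Fintype n] [DecidableEq n] (P : Matrix m m R) (K : Matrix m n R) (E : Matrix n m R)
    (Q : Matrix n n R) :
    (Matrix.fromBlocks P (K * Q) E Q).det = Q.det * (P - K * E).det := by
  have h : Matrix.fromBlocks P (K * Q) E Q =
      Matrix.fromBlocks 1 K 0 1 * Matrix.fromBlocks (P - K * E) 0 E Q := by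
    simp [Matrix.fromBlocks_multiply]
  rw [h, Matrix.det_mul, Matrix.det_fromBlocks_zero₂₁, Matrix.det_fromBlocks_zero₁₂]
  simp [mul_comm]

/-- The matrix whose antidiagonal entries are `1` has determinant `(-1) ^ (n choose 2)`. -/
theorem det_antidiagonal {R : Type*} [CommRing R] (n : ℕ) :
    (Matrix.of fun i j : Fin n => if i.1 + 1 + j.1 = n then (1 : R) else 0).det =
      (-1) ^ n.choose 2 := by
  induction n with
  | zero => simp
  | succ n ih =>
    rw [Matrix.det_succ_column _ (Fin.last n), Fin.sum_univ_succ, Finset.sum_eq_zero]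
    · have h : (Matrix.submatrix (Matrix.of fun i j : Fin (n + 1) =>
          if i.1 + 1 + j.1 = n + 1 then (1 : R) else 0)
          (Fin.succAbove 0) (Fin.last n).succAbove) =
          Matrix.of fun i j : Fin n => if i.1 + 1 + j.1 = n then (1 : R) else 0 := by
        ext i j
        simp only [Matrix.submatrix_apply, Matrix.of_apply, Fin.zero_succAbove,
          Fin.succAbove_last, Fin.val_succ, Fin.val_castSucc]
        congr 1
        simp only [eq_iff_iff]; omega
      rw [h, ih, Nat.choose_succ_succ' n 1]
      simp [pow_add, add_comm 1 n]
    · intro i _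
      rw [Matrix.of_apply, if_neg (by simp; omega), mul_zero, zero_mul]

theorem det_borderedMatrix_add {F : Type*} [Field F] {q t : F} (hq : q ≠ 0) (ht : t ≠ 0)
    (N m : ℕ) (e : ℕ → F) :
    (borderedMatrix q t N (m + 1 + (N + N)) e).det =
      t ^ N * q ^ (N * (2 * m + N + 1)) * (borderedMatrix q t N (m + 1) fun c =>
        e c + ∑ τ ∈ Finset.range N,
          e (m + 1 + (N + τ)) / (t * q ^ (m + 1 + τ)) * sparseCoeff q t N (m + 1 + τ) c).det := by
  let σ : Fin (m + 1) ⊕ (Fin N ⊕ Fin N) ≃ Fin (m + 1 + (N + N)) :=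
    (Equiv.sumCongr (Equiv.refl _) finSumFinEquiv).trans finSumFinEquiv
  have s1 : ∀ a, (σ (Sum.inl a)).val = a.val := fun a => by simp [σ]
  have s2 : ∀ a, (σ (Sum.inr (Sum.inl a))).val = m + 1 + a.val := fun a => by simp [σ]
  have s3 : ∀ a, (σ (Sum.inr (Sum.inr a))).val = m + 1 + (N + a.val) := fun a => by
    simp [σ, add_comm]
  set M := (borderedMatrix q t N (m + 1 + (N + N)) e).submatrix σ σ with hM
  have hMa : ∀ a b, M a b = if (σ a).val = 0 then e (σ b).val
      else sparseCoeff q t N (σ a).val (σ b).val := fun a b => rfl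
  have hQ : M.toBlocks₂₂ = Matrix.fromBlocks M.toBlocks₂₂.toBlocks₁₁
      (Matrix.diagonal fun τ : Fin N => -(t * q ^ (m + 1 + τ.1)))
      (Matrix.diagonal fun τ : Fin N => q ^ (m + 1 + τ.1)) 0 := by
    ext (i | i) (j | j)
    · rfl
    · simp only [Matrix.toBlocks₂₂, Matrix.of_apply, hMa, s2, s3, Matrix.fromBlocks_apply₁₂,
        Matrix.diagonal_apply, Fin.ext_iff, sparseCoeff]
      by_cases hij : (i : ℕ) = j
      · rw [if_neg (by omega), if_neg (by omega), if_neg (by omega), if_pos (by omega),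
          if_pos hij]
        ring
      · rw [if_neg (by omega), if_neg (by omega), if_neg (by omega), if_neg (by omega),
          if_neg hij]
        ring
    · simp only [Matrix.toBlocks₂₂, Matrix.of_apply, hMa, s2, s3, Matrix.fromBlocks_apply₂₁,
        Matrix.diagonal_apply, Fin.ext_iff, sparseCoeff]
      by_cases hij : (i : ℕ) = j
      · rw [if_neg (by omega), if_neg (by omega), if_pos (by omega), if_neg (by omega),
          if_pos hij, hij]
        ring
      · rw [if_neg (by omega), if_neg (by omega), if_neg (by omega), if_neg (by omega),
          if_neg hij]
        ring
    · simp only [Matrix.toBlocks₂₂, Matrix.of_apply, hMa, s3, Matrix.fromBlocks_apply₂₂,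
        Matrix.zero_apply, sparseCoeff]
      rw [if_neg (by omega), if_neg (by omega), if_neg (by omega), if_neg (by omega)]
      ring
  have hdet : M.toBlocks₂₂.det = t ^ N * q ^ (N * (2 * m + N + 1)) := by
    rw [hQ, det_fromBlocks_zero_corner, Matrix.det_diagonal, Matrix.det_diagonal]
    have h1 : ∏ τ : Fin N, q ^ (m + 1 + τ.1) * q ^ (m + 1 + τ.1) = q ^ (N * (2 * m + N + 1)) := by
      simp only [← pow_add]
      rw [Finset.prod_pow_eq_pow_sum,
        Fin.sum_univ_eq_sum_range (fun i => m + 1 + i + (m + 1 + i))]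
      congr 1
      clear * -
      induction N with
      | zero => simp
      | succ N ih => rw [Finset.sum_range_succ, ih]; ring
    rw [← h1, Finset.prod_mul_distrib, Finset.prod_neg, Finset.prod_mul_distrib]
    simp only [Finset.card_univ, Fintype.card_fin, Finset.prod_const]
    have : ((-1 : F) ^ N) * (-1) ^ N = 1 := by rw [← mul_pow]; simp
    linear_combination (t ^ N * (∏ τ : Fin N, q ^ (m + 1 + τ.1)) *
      (∏ τ : Fin N, q ^ (m + 1 + τ.1))) * this
  have hunit : IsUnit M.toBlocks₂₂.det := by
    rw [hdet]
    exact (mul_ne_zero (pow_ne_zero _ ht) (pow_ne_zero _ hq)).isUnit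
  set K := M.toBlocks₁₂ * M.toBlocks₂₂⁻¹ with hK
  have hKQ : K * M.toBlocks₂₂ = M.toBlocks₁₂ := by
    rw [hK, Matrix.mul_assoc, Matrix.nonsing_inv_mul _ hunit, Matrix.mul_one]
  have hKl : ∀ a (τ : Fin N), K a (Sum.inl τ) * -(t * q ^ (m + 1 + τ.1)) =
      if a.val = 0 then e (m + 1 + (N + τ)) else 0 := by
    intro a τ
    have h := congrFun (congrFun hKQ a) (Sum.inr τ)
    rw [hQ, Matrix.mul_apply, Fintype.sum_sum_type] at h
    simp only [Matrix.fromBlocks_apply₁₂, Matrix.fromBlocks_apply₂₂, Matrix.zero_apply, mul_zero,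
      Finset.sum_const_zero, add_zero, Matrix.diagonal_apply, mul_ite, Finset.sum_ite_eq',
      Finset.mem_univ, if_true] at h
    rw [h]
    simp only [Matrix.toBlocks₁₂, Matrix.of_apply, hMa, s1, s3]
    split_ifs with h0
    · rfl
    · simp only [sparseCoeff]
      have := a.isLt
      rw [if_neg (by omega), if_neg (by omega), if_neg (by omega)]
      ring
  rw [← Matrix.det_submatrix_equiv_self σ, ← hM, ← Matrix.fromBlocks_toBlocks M, ← hKQ,
    det_fromBlocks_mul_right_block, hdet]
  congr 2
  ext a c
  have hlow : ∀ τ : Fin N, M.toBlocks₂₁ (Sum.inr τ) c = 0 := by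
    intro τ
    have := c.isLt
    simp only [Matrix.toBlocks₂₁, Matrix.of_apply, hMa, s1, s3, sparseCoeff]
    rw [if_neg (by omega), if_neg (by omega), if_neg (by omega), if_neg (by omega)]
    ring
  have hmid : ∀ τ : Fin N, M.toBlocks₂₁ (Sum.inl τ) c = sparseCoeff q t N (m + 1 + τ) c := by
    intro τ
    simp only [Matrix.toBlocks₂₁, Matrix.of_apply, hMa, s1, s2]
    rw [if_neg (by omega)]
  have hKl' : ∀ τ : Fin N, K a (Sum.inl τ) =
      -((if a.val = 0 then e (m + 1 + (N + τ)) else 0) / (t * q ^ (m + 1 + τ.1))) := by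
    intro τ
    rw [← hKl a τ]
    field_simp
  rw [Matrix.sub_apply, Matrix.mul_apply, Fintype.sum_sum_type]
  simp only [hlow, hmid, hKl', mul_zero, Finset.sum_const_zero, add_zero]
  simp only [Matrix.toBlocks₁₁, borderedMatrix, Matrix.of_apply, hMa, s1]
  split_ifs with h0
  · rw [← Fin.sum_univ_eq_sum_range (fun τ => e (m + 1 + (N + τ)) / (t * q ^ (m + 1 + τ)) *
      sparseCoeff q t N (m + 1 + τ) c)]
    simp
  · simp

/-- The linear form in the bordering row `e` to which `(borderedMatrix q t N _ e).det` is
proportional. -/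
def borderForm {R : Type*} [CommRing R] (q t : R) (N n : ℕ) (e : ℕ → R) : R :=
  ∑ s ∈ Finset.range (n / 2 + 1), (t * q ^ N) ^ s * e ((n - 2 * s) * N)

theorem borderForm_add_two {R : Type*} [CommRing R] (q t : R) (N n : ℕ) (e : ℕ → R) :
    borderForm q t N (n + 2) e = e ((n + 2) * N) + t * q ^ N * borderForm q t N n e := by
  rw [borderForm, show (n + 2) / 2 + 1 = (n / 2 + 1) + 1 by omega, Finset.sum_range_succ',
    borderForm, Finset.mul_sum]
  simp only [pow_zero, one_mul, mul_zero, Nat.sub_zero]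
  rw [add_comm]
  congr 1
  refine Finset.sum_congr rfl fun s _ => ?_
  rw [show n + 2 - 2 * (s + 1) = n - 2 * s by omega]
  ring

theorem det_borderedMatrix_add_of_forall {F : Type*} [Field F] {q t : F} (hq : q ≠ 0)
    (ht : t ≠ 0) {k n m : ℕ} {κ : F} (hm : n * (k + 1) ≤ m) (hm' : m < n * (k + 1) + (k + 1))
    (h : ∀ e, (borderedMatrix q t (k + 1) (m + 1) e).det = κ * borderForm q t (k + 1) n e)
    (e : ℕ → F) :
    (borderedMatrix q t (k + 1) (m + 2 * (k + 1) + 1) e).det =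
      κ * t ^ k * q ^ ((k + 1) * (2 * m + (k + 1))) * borderForm q t (k + 1) (n + 2) e := by
  rw [show m + 2 * (k + 1) + 1 = m + 1 + ((k + 1) + (k + 1)) by ring,
    det_borderedMatrix_add hq ht, h, borderForm_add_two]
  set N := k + 1 with hN
  have hsum : ∀ s, 2 * s ≤ n → ∑ τ ∈ Finset.range N, e (m + 1 + (N + τ)) / (t * q ^ (m + 1 + τ)) *
      sparseCoeff q t N (m + 1 + τ) ((n - 2 * s) * N) =
      if s = 0 then e ((n + 2) * N) / (t * q ^ N) else 0 := by
    intro s hs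
    split_ifs with h0
    · subst h0
      rw [mul_zero, Nat.sub_zero, Finset.sum_eq_single (n * N + N - m - 1)]
      · rw [show m + 1 + (N + (n * N + N - m - 1)) = (n + 2) * N by
            rw [add_mul]; omega,
          show m + 1 + (n * N + N - m - 1) = N + n * N by omega]
        rcases Nat.eq_zero_or_pos n with rfl | hn
        · simp [sparseCoeff]
        · have : N ≤ n * N := Nat.le_mul_of_pos_left N hn
          simp only [sparseCoeff]
          rw [if_neg (by omega), if_pos ⟨trivial, by omega⟩, if_neg (by omega), pow_add]
          field_simp
          ring
      · intro τ hτ hne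
        have hτ := Finset.mem_range.mp hτ
        rcases Nat.eq_zero_or_pos n with rfl | hn
        · simp only [sparseCoeff]
          rw [if_neg (by omega), if_neg (by omega), if_neg (by omega)]
          ring
        · have : N ≤ n * N := Nat.le_mul_of_pos_left N hn
          simp only [sparseCoeff]
          rw [if_neg (by omega), if_neg (by omega), if_neg (by omega)]
          ring
      · intro hτ
        exact absurd (Finset.mem_range.mpr (by omega)) hτ
    · refine Finset.sum_eq_zero fun τ hτ => ?_
      have hτ := Finset.mem_range.mp hτ
      have h1 : (n - 2 * s + 1) * N ≤ n * N := Nat.mul_le_mul_right N (by omega)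
      have h2 : (n - 2 * s + 1) * N = (n - 2 * s) * N + N := by ring
      simp only [sparseCoeff]
      rw [if_neg (by omega), if_neg (by omega), if_neg (by omega)]
      ring
  have hform : borderForm q t N n (fun c => e c + ∑ τ ∈ Finset.range N,
      e (m + 1 + (N + τ)) / (t * q ^ (m + 1 + τ)) * sparseCoeff q t N (m + 1 + τ) c) =
      borderForm q t N n e + e ((n + 2) * N) / (t * q ^ N) := by
    simp only [borderForm, mul_add, Finset.sum_add_distrib]
    congr 1
    rw [Finset.sum_eq_single 0]
    · rw [hsum 0 (by omega)]; simp
    · intro s hs h0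
      have := Finset.mem_range.mp hs
      rw [hsum s (by omega), if_neg h0, mul_zero]
    · simp
  rw [hform]
  have e1 : t ^ N = t ^ k * t := by rw [hN, pow_succ]
  have e2 : q ^ (N * (2 * m + N + 1)) = q ^ (N * (2 * m + N)) * q ^ N := by
    rw [← pow_add]; ring
  rw [e1, e2]
  field_simp
  ring

section Base

variable {R : Type*} [CommRing R] (q t : R) (k : ℕ) (e : ℕ → R)

theorem det_borderedMatrix_one : (borderedMatrix q t (k + 1) 1 e).det = e 0 := by
  simp [borderedMatrix]

theorem det_borderedMatrix_self :
    (borderedMatrix q t (k + 1) (k + 1) e).det = (-1) ^ k.choose 2 * e 0 := by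
  rw [Matrix.det_succ_column_zero, Fin.sum_univ_succ, Finset.sum_eq_zero]
  · have h : (borderedMatrix q t (k + 1) (k + 1) e).submatrix (Fin.succAbove 0) Fin.succ =
        Matrix.of fun i j : Fin k => if i.1 + 1 + j.1 = k then (1 : R) else 0 := by
      ext i j
      have := i.isLt
      have := j.isLt
      simp only [borderedMatrix, sparseCoeff, Matrix.submatrix_apply, Matrix.of_apply,
        Fin.zero_succAbove, Fin.val_succ]
      rw [if_neg (by omega), if_neg (by omega : ¬ (_ ∧ _)), if_neg (by omega : ¬ j.1 + 1 = _)]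
      simp only [show i.1 + 1 + (j.1 + 1) = k + 1 ↔ i.1 + 1 + j.1 = k by omega]
      ring
    rw [h, det_antidiagonal]
    simp [borderedMatrix, mul_comm]
  · intro i _
    have := i.isLt
    have h0 : borderedMatrix q t (k + 1) (k + 1) e i.succ 0 = 0 := by
      simp only [borderedMatrix, Matrix.of_apply, Fin.val_succ, Fin.val_zero]
      simp only [sparseCoeff]
      rw [if_neg (by omega), if_neg (by omega), if_neg (by omega), if_neg (by omega)]
      ring
    rw [h0]
    ring

theorem det_borderedMatrix_eq_zero_of_lt {p : ℕ} (hp : 0 < p) (hpk : p < k) :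
    (borderedMatrix q t (k + 1) (p + 1) e).det = 0 := by
  refine Matrix.det_eq_zero_of_row_eq_zero ⟨1, by omega⟩ fun j => ?_
  have := j.isLt
  simp only [borderedMatrix, sparseCoeff, Matrix.of_apply]
  rw [if_neg (by omega), if_neg (by omega), if_neg (by omega), if_neg (by omega)]
  ring

theorem det_borderedMatrix_succ :
    (borderedMatrix q t (k + 1) (k + 1 + 1) e).det = (-1) ^ (k + 2).choose 2 * e (k + 1) := by
  rw [Matrix.det_succ_column _ (Fin.last (k + 1)), Fin.sum_univ_succ, Finset.sum_eq_zero]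
  · have h : (borderedMatrix q t (k + 1) (k + 1 + 1) e).submatrix (Fin.succAbove 0)
        (Fin.last (k + 1)).succAbove =
        Matrix.of fun i j : Fin (k + 1) => if i.1 + 1 + j.1 = k + 1 then (1 : R) else 0 := by
      ext i j
      have := i.isLt
      have := j.isLt
      simp only [borderedMatrix, sparseCoeff, Matrix.submatrix_apply, Matrix.of_apply,
        Fin.zero_succAbove, Fin.succAbove_last, Fin.val_succ, Fin.val_castSucc]
      rw [if_neg (by omega), if_neg (by omega : ¬ (_ ∧ _)), if_neg (by omega : ¬ j.1 = _)]
      ring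
    rw [h, det_antidiagonal, Nat.choose_succ_succ' (k + 1) 1]
    simp [borderedMatrix, pow_add]
    ring
  · intro i _
    have := i.isLt
    simp only [borderedMatrix, sparseCoeff, Matrix.of_apply, Fin.val_succ, Fin.val_last]
    rw [if_neg (by omega), if_neg (by omega), if_neg (by omega), if_neg (by omega)]
    ring

theorem det_borderedMatrix_add_self :
    (borderedMatrix q t (k + 1) (k + 1 + (k + 1)) e).det =
      -(t ^ k * q ^ (k * (k + 1)) * e (k + 1)) := by
  set M := (borderedMatrix q t (k + 1) (k + 1 + (k + 1)) e).submatrix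
    finSumFinEquiv finSumFinEquiv with hM
  let B : Matrix (Fin (k + 1)) (Fin (k + 1)) R := Matrix.of fun i j =>
    if i.1 = 0 then e (k + 1 + j) else if i = j then -(t * q ^ i.1) else 0
  have hMQ : M = Matrix.fromBlocks M.toBlocks₁₁ B (Matrix.diagonal fun i => q ^ i.1) 0 := by
    ext (i | i) (j | j)
    · rfl
    · have := i.isLt
      have := j.isLt
      simp only [hM, borderedMatrix, sparseCoeff, Matrix.submatrix_apply, Matrix.of_apply,
        finSumFinEquiv_apply_left, finSumFinEquiv_apply_right, Fin.val_natAdd, Fin.val_castAdd,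
        Matrix.fromBlocks_apply₁₂, B, Fin.ext_iff]
      by_cases h0 : (i : ℕ) = 0
      · rw [if_pos h0, if_pos h0]
      · rw [if_neg h0, if_neg h0, if_neg (by omega), if_neg (by omega)]
        by_cases hij : (i : ℕ) = j
        · rw [if_pos (by omega), if_pos hij]; ring
        · rw [if_neg (by omega), if_neg hij]; ring
    · have := i.isLt
      have := j.isLt
      simp only [hM, borderedMatrix, sparseCoeff, Matrix.submatrix_apply, Matrix.of_apply,
        finSumFinEquiv_apply_left, finSumFinEquiv_apply_right, Fin.val_natAdd, Fin.val_castAdd,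
        Matrix.fromBlocks_apply₂₁, Matrix.diagonal_apply, Fin.ext_iff]
      rw [if_neg (by omega), if_neg (by omega : ¬ j.1 = _)]
      by_cases hij : (i : ℕ) = j
      · rw [if_pos hij, show q ^ i.1 = q ^ j.1 by rw [hij]]
        by_cases h0 : (j : ℕ) = 0
        · rw [if_pos (by omega), if_neg (by omega), h0]; ring
        · rw [if_neg (by omega), if_pos (by omega)]; ring
      · rw [if_neg hij, if_neg (by omega), if_neg (by omega)]; ring
    · simp only [hM, borderedMatrix, sparseCoeff, Matrix.submatrix_apply, Matrix.of_apply,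
        finSumFinEquiv_apply_right, Fin.val_natAdd, Matrix.fromBlocks_apply₂₂, Matrix.zero_apply]
      have := i.isLt
      have := j.isLt
      rw [if_neg (by omega), if_neg (by omega), if_neg (by omega), if_neg (by omega)]
      ring
  have hB : B.det = e (k + 1) * ((-1) ^ k * t ^ k * q ^ (k + 1).choose 2) := by
    rw [Matrix.det_of_isUpperTriangular]
    · rw [Fin.prod_univ_succ]
      have h : ∀ i : Fin k, B i.succ i.succ = (-1) * t * q ^ (i.1 + 1) := fun i => by simp [B]
      simp only [h]
      rw [Finset.prod_mul_distrib, Finset.prod_const, Finset.card_univ, Fintype.card_fin,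
        Finset.prod_pow_eq_pow_sum, Fin.sum_univ_eq_sum_range (fun i => i + 1),
        sum_range_add_one, mul_pow]
      simp [B]
    · intro i j hij
      simp only [id] at hij
      have h0 : ¬ i.1 = 0 := by have := Fin.lt_def.mp hij; omega
      simp only [B, Matrix.of_apply, if_neg h0, if_neg hij.ne']
  have hC : (Matrix.diagonal fun i : Fin (k + 1) => q ^ i.1).det = q ^ (k + 1).choose 2 := by
    rw [Matrix.det_diagonal, Finset.prod_pow_eq_pow_sum, Fin.sum_univ_eq_sum_range (fun i => i),
      Finset.sum_range_succ', sum_range_add_one, add_zero]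
  have hch : (k + 1).choose 2 + (k + 1).choose 2 = k * (k + 1) := by
    rw [Nat.choose_two_right, Nat.add_sub_cancel, ← mul_two, mul_comm (k + 1) k,
      Nat.div_mul_cancel (Nat.even_mul_succ_self k).two_dvd]
  rw [← Matrix.det_submatrix_equiv_self finSumFinEquiv, ← hM, hMQ, det_fromBlocks_zero_corner, hB,
    hC, Fintype.card_fin, ← hch, pow_add q]
  have : ((-1 : R) ^ k) * (-1) ^ k = 1 := by rw [← mul_pow]; simp
  rw [pow_succ]
  linear_combination (-(e (k + 1) * t ^ k * q ^ (k + 1).choose 2 * q ^ (k + 1).choose 2)) * this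

theorem det_borderedMatrix_add_eq_zero_of_lt {p : ℕ} (hp : 0 < p) (hpk : p < k) :
    (borderedMatrix q t (k + 1) (k + 1 + p + 1) e).det = 0 := by
  have hne : (⟨k, by omega⟩ : Fin (k + 1 + p + 1)) ≠ ⟨k + 2, by omega⟩ := by simp
  rw [← Matrix.det_updateRow_add_smul_self _ hne.symm (-q)]
  refine Matrix.det_eq_zero_of_row_eq_zero ⟨k + 2, by omega⟩ fun j => ?_
  have := j.isLt
  rw [Matrix.updateRow_self]
  change (if k + 2 = 0 then e j else sparseCoeff q t (k + 1) (k + 2) j) +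
    -q * (if k = 0 then e j else sparseCoeff q t (k + 1) k j) = 0
  rw [if_neg (by omega), if_neg (by omega), sparseCoeff, sparseCoeff,
    if_neg (by omega : ¬ k + 2 + j.1 = _), if_neg (by omega : ¬ j.1 = k + 2 + (k + 1)),
    if_neg (by omega : ¬ (k = k + 1 + j.1 ∧ _)), if_neg (by omega : ¬ j.1 = k + (k + 1))]
  by_cases h1 : j.1 = 1
  · rw [if_pos (by omega), if_pos (by omega), h1]; ring
  · rw [if_neg (by omega), if_neg (by omega)]; ring

theorem borderForm_zero (N : ℕ) : borderForm q t N 0 e = e 0 := by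
  simp [borderForm]

theorem borderForm_one (N : ℕ) : borderForm q t N 1 e = e N := by
  simp [borderForm]

end Base

theorem det_borderedMatrix_mul {F : Type*} [Field F] {q t : F} (hq : q ≠ 0) (ht : t ≠ 0)
    (k n : ℕ) (e : ℕ → F) :
    (borderedMatrix q t (k + 1) (n * (k + 1) + 1) e).det =
      (-1) ^ (n * (k + 2).choose 2) * t ^ (k * (n / 2)) * q ^ ((k + 1) ^ 2 * n.choose 2) *
        borderForm q t (k + 1) n e := by
  induction n using Nat.twoStepInduction generalizing e with
  | zero =>
    rw [zero_mul, zero_add, det_borderedMatrix_one, borderForm_zero]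
    simp
  | one =>
    rw [one_mul, det_borderedMatrix_succ, borderForm_one]
    simp
  | more n ih _ =>
    have h := det_borderedMatrix_add_of_forall hq ht le_rfl (by omega) ih e
    rw [show (n + 2) * (k + 1) + 1 = n * (k + 1) + 2 * (k + 1) + 1 by ring, h]
    rw [show (n + 2) / 2 = n / 2 + 1 by omega, Nat.choose_succ_succ' (n + 1) 1,
      Nat.choose_succ_succ' n 1, Nat.choose_one_right, Nat.choose_one_right, add_mul n 2,
      pow_add (-1 : F), pow_mul _ 2 (Nat.choose _ _)]
    ring

theorem det_borderedMatrix_mul_add {F : Type*} [Field F] {q t : F} (hq : q ≠ 0) (ht : t ≠ 0)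
    (k n : ℕ) (e : ℕ → F) :
    (borderedMatrix q t (k + 1) (n * (k + 1) + k + 1) e).det =
      (-1) ^ (n * (k + 2).choose 2 + k.choose 2) * t ^ (k * ((n + 1) / 2)) *
        q ^ ((k + 1) ^ 2 * n.choose 2 + n * k * (k + 1)) * borderForm q t (k + 1) n e := by
  induction n using Nat.twoStepInduction generalizing e with
  | zero =>
    rw [zero_mul, zero_add, det_borderedMatrix_self, borderForm_zero]
    simp
  | one =>
    rw [one_mul, add_assoc (k + 1), det_borderedMatrix_add_self, borderForm_one,
      Nat.choose_succ_succ' (k + 1) 1, Nat.choose_succ_succ' k 1, Nat.choose_one_right,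
      Nat.choose_one_right]
    have hs : (-1 : F) ^ (1 * (k + 1 + (k + k.choose 2)) + k.choose 2) = -1 := by
      rw [show 1 * (k + 1 + (k + k.choose 2)) + k.choose 2 = 2 * (k + k.choose 2) + 1 by ring,
        pow_succ, pow_mul]
      simp
    rw [hs]
    simp
  | more n ih _ =>
    have h := det_borderedMatrix_add_of_forall hq ht (Nat.le_add_right _ k) (by omega) ih e
    have hs : (-1 : F) ^ ((n + 2) * (k + 2).choose 2 + k.choose 2) =
        (-1) ^ (n * (k + 2).choose 2 + k.choose 2) := by
      rw [show (n + 2) * (k + 2).choose 2 + k.choose 2 =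
        n * (k + 2).choose 2 + k.choose 2 + 2 * (k + 2).choose 2 by ring, pow_add, pow_mul _ 2]
      simp
    rw [show (n + 2) * (k + 1) + k + 1 = n * (k + 1) + k + 2 * (k + 1) + 1 by ring, h, hs]
    rw [show (n + 2 + 1) / 2 = (n + 1) / 2 + 1 by omega, Nat.choose_succ_succ' (n + 1) 1,
      Nat.choose_succ_succ' n 1, Nat.choose_one_right, Nat.choose_one_right]
    ring

theorem det_borderedMatrix_eq_zero {F : Type*} [Field F] {q t : F} (hq : q ≠ 0) (ht : t ≠ 0)
    {k p : ℕ} (hp : 0 < p) (hpk : p < k) (n : ℕ) (e : ℕ → F) :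
    (borderedMatrix q t (k + 1) (n * (k + 1) + p + 1) e).det = 0 := by
  induction n using Nat.twoStepInduction generalizing e with
  | zero => rw [zero_mul, zero_add, det_borderedMatrix_eq_zero_of_lt q t k e hp hpk]
  | one => rw [one_mul, det_borderedMatrix_add_eq_zero_of_lt q t k e hp hpk]
  | more n ih _ =>
    have h := det_borderedMatrix_add_of_forall (k := k) (κ := 0) (n := n) hq ht
      (Nat.le_add_right _ p) (by omega) (fun e => by rw [ih, zero_mul]) e
    rw [show (n + 2) * (k + 1) + p + 1 = n * (k + 1) + p + 2 * (k + 1) + 1 by ring, h]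
    ring

theorem borderForm_eq_sum {R : Type*} [CommRing R] (x y t : R) {N : ℕ} (hN : 0 < N) (n : ℕ) :
    borderForm (x * y) t N n (fun c => if c = 0 then 1 else (-x) ^ c + (-y) ^ c) =
      (-1) ^ (n * N) * ∑ s ∈ Finset.range (n + 1),
        t ^ min s (n - s) * x ^ (s * N) * y ^ ((n - s) * N) := by
  induction n using Nat.twoStepInduction with
  | zero => simp [borderForm_zero]
  | one =>
    rw [borderForm_one, if_neg hN.ne', Finset.sum_range_succ, Finset.sum_range_one, neg_pow x,
      neg_pow y]
    simp
    ring
  | more n ih _ =>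
    have h : ∀ s ∈ Finset.range (n + 1),
        t ^ min (s + 1) (n + 2 - (s + 1)) * x ^ ((s + 1) * N) * y ^ ((n + 2 - (s + 1)) * N) =
          t * (x * y) ^ N * (t ^ min s (n - s) * x ^ (s * N) * y ^ ((n - s) * N)) := by
      intro s hs
      have := Finset.mem_range.mp hs
      rw [show n + 2 - (s + 1) = n - s + 1 by omega,
        show min (s + 1) (n - s + 1) = min s (n - s) + 1 by omega]
      ring
    have h1 : ((-1 : R) ^ N) * (-1) ^ N = 1 := by rw [← mul_pow]; simp
    have h2 : (-1 : R) ^ ((n + 2) * N) = (-1) ^ (n * N) := by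
      rw [add_mul, pow_add, two_mul, pow_add, h1, mul_one]
    rw [borderForm_add_two, ih, if_neg (Nat.mul_pos (by omega) hN).ne', neg_pow x, neg_pow y, h2,
      Finset.sum_range_succ _ (n + 2), Finset.sum_range_succ' _ (n + 1),
      Finset.sum_congr rfl h, ← Finset.mul_sum]
    simp
    ring

theorem map_pgf {R S : Type*} [CommRing R] [CommRing S] (f : R →+* S) (x y : R) (n : ℕ) (k : ℤ) :
    f (pgf x y n k) = pgf (f x) (f y) n k := by
  simp only [pgf, map_sum, apply_ite f, map_mul, map_pow, map_natCast, map_zero]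

theorem map_thm9Matrix {R S : Type*} [CommRing R] [CommRing S] (f : R →+* S) (x y t : R) (n : ℕ)
    (k : ℤ) : f.mapMatrix (thm9Matrix x y t n k) = thm9Matrix (f x) (f y) (f t) n k := by
  ext i j
  simp [thm9Matrix, map_pgf]

/-- A determinant identity for `thm9Matrix` whose right-hand side is compatible with ring
homomorphisms holds over all commutative rings as soon as it holds over fields. -/
theorem det_thm9Matrix_of_field (n : ℕ) (k : ℤ) (p : MvPolynomial (Fin 3) ℤ)
    (h : ∀ {F : Type} [Field F] (x y t : F), x * y ≠ 0 → t ≠ 0 →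
      (thm9Matrix x y t n k).det = MvPolynomial.eval₂Hom (Int.castRingHom _) ![x, y, t] p)
    {R : Type*} [CommRing R] (x y t : R) :
    (thm9Matrix x y t n k).det = MvPolynomial.eval₂Hom (Int.castRingHom _) ![x, y, t] p := by
  let S := MvPolynomial (Fin 3) ℤ
  let X : Fin 3 → S := MvPolynomial.X
  let ι := algebraMap S (FractionRing S)
  have hι : Function.Injective ι := IsFractionRing.injective S (FractionRing S)
  have hX : ∀ i, ι (X i) ≠ 0 := fun i =>
    (map_ne_zero_iff ι hι).mpr (MvPolynomial.X_ne_zero i)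
  have generic : (thm9Matrix (X 0) (X 1) (X 2) n k).det = p := by
    apply hι
    rw [RingHom.map_det, map_thm9Matrix, h _ _ _ (mul_ne_zero (hX 0) (hX 1)) (hX 2)]
    have hι' : MvPolynomial.eval₂Hom (Int.castRingHom _) ![ι (X 0), ι (X 1), ι (X 2)] = ι := by
      refine MvPolynomial.ringHom_ext (fun r => by simp) fun i => ?_
      rw [MvPolynomial.eval₂Hom_X']
      fin_cases i <;> rfl
    rw [hι']
  let f : S →+* R := MvPolynomial.eval₂Hom (Int.castRingHom R) ![x, y, t]
  have hf : ∀ i, f (X i) = ![x, y, t] i := MvPolynomial.eval₂Hom_X' _ _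
  have := congrArg f generic
  rw [RingHom.map_det, map_thm9Matrix, hf, hf, hf] at this
  exact this

theorem neg_one_pow_mul_choose_add_two (R : Type*) [CommRing R] (n k d : ℕ) :
    (-1 : R) ^ (n * (k + 2).choose 2 + d) * (-1) ^ (n * (k + 1)) =
      (-1) ^ (n * (k + 1).choose 2 + d) := by
  rw [← pow_add, Nat.choose_succ_succ' (k + 1) 1, Nat.choose_one_right,
    show n * (k + 1 + (k + 1).choose 2) + d + n * (k + 1) =
      n * (k + 1).choose 2 + d + 2 * (n * (k + 1)) by ring, pow_add, pow_mul _ 2]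
  simp

theorem det_thm9Matrix_mul {R : Type*} [CommRing R] (x y t : R) (k n : ℕ) :
    (thm9Matrix x y t (n * (k + 1)) (k : ℤ)).det =
      (-1) ^ (n * (k + 1).choose 2) * t ^ (k * (n / 2)) * (x * y) ^ ((k + 1) ^ 2 * n.choose 2) *
        ∑ s ∈ Finset.range (n + 1),
          t ^ min s (n - s) * x ^ (s * (k + 1)) * y ^ ((n - s) * (k + 1)) := by
  have := det_thm9Matrix_of_field (n * (k + 1)) k
    ((-1) ^ (n * (k + 1).choose 2) * .X 2 ^ (k * (n / 2)) *
      (.X 0 * .X 1) ^ ((k + 1) ^ 2 * n.choose 2) *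
      ∑ s ∈ Finset.range (n + 1), .X 2 ^ min s (n - s) * .X 0 ^ (s * (k + 1)) *
        .X 1 ^ ((n - s) * (k + 1))) ?_ x y t
  · simpa using this
  · intro F _ x y t hq ht
    rw [det_thm9Matrix_eq_det_borderedMatrix, add_comm 1, det_borderedMatrix_mul hq ht,
      borderForm_eq_sum x y t k.succ_pos]
    have h1 := neg_one_pow_mul_choose_add_two F n k 0
    rw [add_zero, add_zero] at h1
    simp only [map_mul, map_pow, map_neg, map_one, map_sum, MvPolynomial.eval₂Hom_X', ← h1]
    simp
    ring

theorem det_thm9Matrix_mul_add {R : Type*} [CommRing R] (x y t : R) (k n : ℕ) :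
    (thm9Matrix x y t (n * (k + 1) + k) (k : ℤ)).det =
      (-1) ^ (n * (k + 1).choose 2 + k.choose 2) * t ^ (k * ((n + 1) / 2)) *
        (x * y) ^ ((k + 1) ^ 2 * n.choose 2 + n * k * (k + 1)) *
        ∑ s ∈ Finset.range (n + 1),
          t ^ min s (n - s) * x ^ (s * (k + 1)) * y ^ ((n - s) * (k + 1)) := by
  have := det_thm9Matrix_of_field (n * (k + 1) + k) k
    ((-1) ^ (n * (k + 1).choose 2 + k.choose 2) * .X 2 ^ (k * ((n + 1) / 2)) *
      (.X 0 * .X 1) ^ ((k + 1) ^ 2 * n.choose 2 + n * k * (k + 1)) *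
      ∑ s ∈ Finset.range (n + 1), .X 2 ^ min s (n - s) * .X 0 ^ (s * (k + 1)) *
        .X 1 ^ ((n - s) * (k + 1))) ?_ x y t
  · simpa using this
  · intro F _ x y t hq ht
    rw [det_thm9Matrix_eq_det_borderedMatrix, add_comm 1, det_borderedMatrix_mul_add hq ht,
      borderForm_eq_sum x y t k.succ_pos]
    simp only [map_mul, map_pow, map_neg, map_one, map_sum, MvPolynomial.eval₂Hom_X',
      ← neg_one_pow_mul_choose_add_two F n k (k.choose 2)]
    simp
    ring

theorem det_thm9Matrix_eq_zero {R : Type*} [CommRing R] (x y t : R) {k p : ℕ} (hp : 0 < p)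
    (hpk : p < k) (n : ℕ) : (thm9Matrix x y t (n * (k + 1) + p) (k : ℤ)).det = 0 := by
  have := det_thm9Matrix_of_field (n * (k + 1) + p) k 0 ?_ x y t
  · simpa using this
  · intro F _ x y t hq ht
    rw [det_thm9Matrix_eq_det_borderedMatrix, add_comm 1,
      det_borderedMatrix_eq_zero hq ht hp hpk, map_zero]

/-- Theorem 9: evaluation of
`det_{0≤i,j≤n−1}(P_{j+1}(i,k) − t(xy)^{i+1}P_{j+1}(−i−2,k))` for nonnegative `k`
(three cases, according to `n = n₁(k+1)` with `n₁ ≥ 1`, `n = n₁(k+1)+k` with `n₁ ≥ 0`,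
or `n ≢ 0, k (mod k+1)`), together with the value `(1−t)^n (xy)^{C(n+1,2)}` for `k = −1`.
Here `⌈n₁/2⌉` is written `(n₁+1)/2` using natural division. -/
theorem det_thm9Matrix {R : Type*} [CommRing R] (x y t : R) (n : ℕ) (hn : 0 < n) :
    (∀ k : ℕ,
      (∀ n₁ : ℕ, 0 < n₁ → n = n₁ * (k + 1) →
        (thm9Matrix x y t n (k : ℤ)).det =
          (-1 : R) ^ (n₁ * Nat.choose (k + 1) 2) * t ^ (k * (n₁ / 2)) *
            (x * y) ^ ((k + 1) ^ 2 * Nat.choose n₁ 2) *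
            ∑ s ∈ Finset.range (n₁ + 1),
              t ^ min s (n₁ - s) * x ^ (s * (k + 1)) * y ^ ((n₁ - s) * (k + 1))) ∧
      (∀ n₁ : ℕ, n = n₁ * (k + 1) + k →
        (thm9Matrix x y t n (k : ℤ)).det =
          (-1 : R) ^ (n₁ * Nat.choose (k + 1) 2 + Nat.choose k 2) *
            t ^ (k * ((n₁ + 1) / 2)) *
            (x * y) ^ ((k + 1) ^ 2 * Nat.choose n₁ 2 + n₁ * k * (k + 1)) *
            ∑ s ∈ Finset.range (n₁ + 1),
              t ^ min s (n₁ - s) * x ^ (s * (k + 1)) * y ^ ((n₁ - s) * (k + 1))) ∧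
      (n % (k + 1) ≠ 0 ∧ n % (k + 1) ≠ k → (thm9Matrix x y t n (k : ℤ)).det = 0)) ∧
    (thm9Matrix x y t n (-1 : ℤ)).det =
      (1 - t) ^ n * (x * y) ^ Nat.choose (n + 1) 2 := by
  refine ⟨fun k => ⟨?_, ?_, ?_⟩, det_thm9Matrix_neg_one x y t n⟩
  · rintro m - rfl
    exact det_thm9Matrix_mul x y t k m
  · rintro m rfl
    exact det_thm9Matrix_mul_add x y t k m
  · rintro ⟨h0, hk⟩
    have hlt : n % (k + 1) < k + 1 := Nat.mod_lt n k.succ_pos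
    rw [← Nat.div_add_mod' n (k + 1)]
    exact det_thm9Matrix_eq_zero x y t (by omega) (by omega) (n / (k + 1))
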